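/- Let S be a special subvariety of Y(1)ⁿ and let (S_q)_{q∈Q} be a parametric family of proper weakly special subvarieties of S. Then only finitely many members of this family are basic special subvarieties of Y(1)ⁿ. -/

import Mathlib

noncomputable section

namespace ModularJPaper

/-! ### Basic objects: the upper half-plane, Möbius actions, the modular `j`-function -/

/-- The complex upper half-plane, as a subset of `ℂ`. -/
def HH : Set ℂ := {z : ℂ | 0 < z.im}

/-- The Möbius action of a complex 2×2 matrix on `ℂ`. -/
def moeb (g : Matrix (Fin 2) (Fin 2) ℂ) (z : ℂ) : ℂ :=
  (g 0 0 * z + g 0 1) / (g 1 0 * z + g 1 1)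

/-- A rational 2×2 matrix viewed as a complex one. -/
def qmat (g : Matrix (Fin 2) (Fin 2) ℚ) : Matrix (Fin 2) (Fin 2) ℂ :=
  g.map (fun a => (a : ℂ))

/-- An integer 2×2 matrix viewed as a complex one. -/
def zmat (g : Matrix (Fin 2) (Fin 2) ℤ) : Matrix (Fin 2) (Fin 2) ℂ :=
  g.map (fun a => (a : ℂ))

/-- `IsModularJ j` says that `j : ℂ → ℂ` restricts on the upper half-plane to *the*
modular `j`-function: it is holomorphic on `ℍ`, invariant under `SL₂(ℤ)`, and has a
Fourier expansion `j(z) = q⁻¹ + 744 + ∑_{k ≥ 1} a_k q^k` with `q = exp(2πiz)`.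
(These properties determine `j` uniquely on `ℍ`.) -/
structure IsModularJ (j : ℂ → ℂ) : Prop where
  holo : DifferentiableOn ℂ j HH
  invariant : ∀ g : Matrix (Fin 2) (Fin 2) ℤ, g.det = 1 → ∀ z ∈ HH, j (moeb (zmat g) z) = j z
  fourier : ∃ a : ℕ → ℂ, ∀ z ∈ HH,
    HasSum (fun k : ℕ => a k * Complex.exp (2 * (Real.pi : ℂ) * Complex.I * z) ^ (k + 1))
      (j z - (Complex.exp (2 * (Real.pi : ℂ) * Complex.I * z))⁻¹ - 744)

/-! ### Algebraic sets, Zariski closure, irreducibility, dimension -/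

/-- `V` is an algebraic subset of `ℂ^ι` (the common zero set of a family of polynomials). -/
def IsAlgSet {ι : Type*} (V : Set (ι → ℂ)) : Prop :=
  ∃ P : Set (MvPolynomial ι ℂ), V = {x | ∀ p ∈ P, MvPolynomial.eval x p = 0}

/-- `V` is an algebraic subset of `ℂ^ι` defined by polynomials with coefficients in `L`. -/
def IsAlgSetOver {ι : Type*} (L : Set ℂ) (V : Set (ι → ℂ)) : Prop :=
  ∃ P : Set (MvPolynomial ι ℂ),
    (∀ p ∈ P, ∀ m : ι →₀ ℕ, MvPolynomial.coeff m p ∈ L) ∧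
    V = {x | ∀ p ∈ P, MvPolynomial.eval x p = 0}

/-- The Zariski closure of a subset of `ℂ^ι`. -/
def zcl {ι : Type*} (S : Set (ι → ℂ)) : Set (ι → ℂ) :=
  ⋂₀ {T | IsAlgSet T ∧ S ⊆ T}

/-- Irreducibility (in the Zariski topology) of a subset of `ℂ^ι`. -/
def IsIrr {ι : Type*} (S : Set (ι → ℂ)) : Prop :=
  S.Nonempty ∧ ∀ V W : Set (ι → ℂ), IsAlgSet V → IsAlgSet W → S ⊆ V ∪ W → S ⊆ V ∨ S ⊆ W

/-- The dimension of (the Zariski closure of) a subset of `ℂ^ι`: the supremum of the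
lengths of strictly increasing chains of irreducible algebraic subsets of its closure. -/
def adim {ι : Type*} (S : Set (ι → ℂ)) : ℕ :=
  sSup {k : ℕ | ∃ c : Fin (k + 1) → Set (ι → ℂ), StrictMono c ∧
    ∀ i, IsAlgSet (c i) ∧ IsIrr (c i) ∧ c i ⊆ zcl S}

/-- `X` is an irreducible component of (the Zariski closure of) the set `A`. -/
def IsIrrCompOf {ι : Type*} (X A : Set (ι → ℂ)) : Prop :=
  IsAlgSet X ∧ IsIrr X ∧ X ⊆ zcl A ∧
    ∀ Y : Set (ι → ℂ), IsAlgSet Y → IsIrr Y → Y ⊆ zcl A → X ⊆ Y → X = Y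

/-- Constructible subsets of `ℂ^ι`: finite unions of differences of algebraic sets. -/
def IsConstr {ι : Type*} (S : Set (ι → ℂ)) : Prop :=
  ∃ (k : ℕ) (A B : Fin k → Set (ι → ℂ)),
    (∀ i, IsAlgSet (A i) ∧ IsAlgSet (B i)) ∧ S = ⋃ i, A i \ B i

/-- No coordinate is constant on `V`. -/
def NoConstCoord {ι : Type*} (V : Set (ι → ℂ)) : Prop :=
  ∀ (i : ι) (c : ℂ), ∃ v ∈ V, v i ≠ c

/-- The fibre of a parametric family `F ⊆ ℂ^ι × ℂ^κ` over the parameter `q`. -/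
def fib {ι κ : Type*} (F : Set ((ι ⊕ κ) → ℂ)) (q : κ → ℂ) : Set (ι → ℂ) :=
  {s | Sum.elim s q ∈ F}

/-! ### Transcendence degree and finitely generated subfields of `ℂ` -/

/-- The transcendence degree `tr.deg_K K(v)` of the field generated over `K` by the
coordinates of the tuple `v`: the maximal size of a subfamily of `v` that is
algebraically independent over `K`. -/
def trdegF (K : Subfield ℂ) {ι : Type*} (v : ι → ℂ) : ℕ :=
  sSup {k : ℕ | ∃ t : Finset ι, t.card = k ∧ AlgebraicIndependent K (fun i : t => v i.1)}

/-- `K` is a finitely generated subfield of `ℂ`. -/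
def FGField (K : Subfield ℂ) : Prop :=
  ∃ s : Finset ℂ, K = Subfield.closure ↑s

/-! ### The set Σ of quadratic points, `GL₂⁺(ℚ)`-orbits, special points -/

/-- `Σ`: the quadratic points of the upper half-plane. -/
def SigmaSet : Set ℂ := {z | z ∈ HH ∧ (minpoly ℚ z).natDegree = 2}

/-- `x` and `y` are related by the Möbius action of an element of `G = GL₂⁺(ℚ)`. -/
def GRel (x y : ℂ) : Prop :=
  ∃ g : Matrix (Fin 2) (Fin 2) ℚ, 0 < g.det ∧ moeb (qmat g) x = y

/-- The `GL₂⁺(ℚ)`-orbit of `x`. -/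
def Gorb (x : ℂ) : Set ℂ := {y | GRel x y}

/-- `dim_G(z | C)`: the number of distinct `G`-orbits of coordinates of the tuple `z`
which contain no element of `C`. -/
def dimG {ι : Type*} (z : ι → ℂ) (C : Set ℂ) : ℕ :=
  Set.ncard {S : Set ℂ | ∃ i : ι, S = Gorb (z i) ∧ ∀ c ∈ C, ¬ GRel (z i) c}

/-- `w` is a special point (singular modulus): `w = j(τ)` for a quadratic `τ ∈ ℍ`. -/
def IsSpecialPt (j : ℂ → ℂ) (w : ℂ) : Prop := ∃ τ ∈ SigmaSet, w = j τ

/-- The zero set of the modular polynomial `Φ_N`, described via the modular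
correspondence: `Φ_N(x,y) = 0` iff `x = j(z)` and `y = j(gz)` for some `z ∈ ℍ` and
some primitive integer matrix `g` of determinant `N`. -/
def PhiRel (j : ℂ → ℂ) (N : ℕ) (x y : ℂ) : Prop :=
  ∃ z ∈ HH, ∃ g : Matrix (Fin 2) (Fin 2) ℤ, g.det = (N : ℤ) ∧
    Nat.gcd (Int.gcd (g 0 0) (g 0 1)) (Int.gcd (g 1 0) (g 1 1)) = 1 ∧
    x = j z ∧ y = j (moeb (zmat g) z)

/-! ### Special, weakly special and Möbius subvarieties -/

/-- An algebraic set cut out by modular relations `Φ_N(Y_i, Y_k) = 0` and by equations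
`Y_i = τ` with `τ` a special point. -/
def IsSpecialBase {ι : Type*} (j : ℂ → ℂ) (B : Set (ι → ℂ)) : Prop :=
  ∃ (R : Set (ι × ι × ℕ)) (E : Set (ι × ℂ)),
    (∀ r ∈ R, 1 ≤ r.2.2) ∧ (∀ e ∈ E, IsSpecialPt j e.2) ∧
    B = {y | (∀ r ∈ R, PhiRel j r.2.2 (y r.1) (y r.2.1)) ∧ ∀ e ∈ E, y e.1 = e.2}

/-- A special subvariety of `Y(1)^ι`: an irreducible component of an algebraic set cut
out by modular relations and special-point constant equations. -/
def IsSpecial {ι : Type*} (j : ℂ → ℂ) (T : Set (ι → ℂ)) : Prop :=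
  ∃ B, IsSpecialBase j B ∧ IsIrrCompOf T B

/-- A weakly special subvariety of `Y(1)^ι`: an irreducible component of an algebraic
set cut out by modular relations and arbitrary constant equations. -/
def IsWSpecial {ι : Type*} (j : ℂ → ℂ) (T : Set (ι → ℂ)) : Prop :=
  ∃ (R : Set (ι × ι × ℕ)) (E : Set (ι × ℂ)), (∀ r ∈ R, 1 ≤ r.2.2) ∧
    IsIrrCompOf T {y | (∀ r ∈ R, PhiRel j r.2.2 (y r.1) (y r.2.1)) ∧ ∀ e ∈ E, y e.1 = e.2}

/-- A weakly special subvariety of complexity at most `N`: only modular polynomials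
`Φ_M` with `M ≤ N` are needed to define it. -/
def IsWSpecialLE {ι : Type*} (j : ℂ → ℂ) (N : ℕ) (T : Set (ι → ℂ)) : Prop :=
  ∃ (R : Set (ι × ι × ℕ)) (E : Set (ι × ℂ)), (∀ r ∈ R, 1 ≤ r.2.2 ∧ r.2.2 ≤ N) ∧
    IsIrrCompOf T {y | (∀ r ∈ R, PhiRel j r.2.2 (y r.1) (y r.2.1)) ∧ ∀ e ∈ E, y e.1 = e.2}

/-- A basic special subvariety: a special subvariety with no constant coordinates. -/
def IsBasicSpecial {ι : Type*} (j : ℂ → ℂ) (T : Set (ι → ℂ)) : Prop :=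
  IsSpecial j T ∧ NoConstCoord T

/-- The special closure of `X`: the smallest special subvariety containing `X`. -/
def spcl {ι : Type*} (j : ℂ → ℂ) (X : Set (ι → ℂ)) : Set (ι → ℂ) :=
  ⋂₀ {T | IsSpecial j T ∧ X ⊆ T}

/-- The weakly special closure of `X`. -/
def wspcl {ι : Type*} (j : ℂ → ℂ) (X : Set (ι → ℂ)) : Set (ι → ℂ) :=
  ⋂₀ {T | IsWSpecial j T ∧ X ⊆ T}

/-- The Möbius relation `M_g(x,y) = y(cx+d) - (ax+b) = 0` attached to a 2×2 matrix. -/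
def MrelC (g : Matrix (Fin 2) (Fin 2) ℂ) (x y : ℂ) : Prop :=
  y * (g 1 0 * x + g 1 1) - (g 0 0 * x + g 0 1) = 0

/-- A 2×2 matrix is non-scalar. -/
def NonScalar (g : Matrix (Fin 2) (Fin 2) ℂ) : Prop :=
  ¬ (g 0 1 = 0 ∧ g 1 0 = 0 ∧ g 0 0 = g 1 1)

/-- A Möbius subvariety of `ℂ^ι`: cut out by finitely many relations `M_g(X_i, X_k) = 0`
with `g` non-scalar in `GL₂(ℂ)`. -/
def IsMoebius {ι : Type*} (M : Set (ι → ℂ)) : Prop :=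
  ∃ (D : Finset (ι × ι)) (f : ι × ι → Matrix (Fin 2) (Fin 2) ℂ),
    (∀ p ∈ D, (f p).det ≠ 0 ∧ NonScalar (f p)) ∧
    M = {x | ∀ p ∈ D, MrelC (f p) (x p.1) (x p.2)}

/-- A Möbius subvariety of `ℂ^ι` defined by matrices in `G = GL₂⁺(ℚ)`. -/
def IsMoebiusQpos {ι : Type*} (M : Set (ι → ℂ)) : Prop :=
  ∃ (D : Finset (ι × ι)) (f : ι × ι → Matrix (Fin 2) (Fin 2) ℚ),
    (∀ p ∈ D, 0 < (f p).det ∧ NonScalar (qmat (f p))) ∧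
    M = {x | ∀ p ∈ D, MrelC (qmat (f p)) (x p.1) (x p.2)}

/-- A Möbius subvariety of `ℂ^ι` defined over `ℚ` (rational invertible non-scalar
matrices). -/
def IsMoebiusRat {ι : Type*} (M : Set (ι → ℂ)) : Prop :=
  ∃ (D : Finset (ι × ι)) (f : ι × ι → Matrix (Fin 2) (Fin 2) ℚ),
    (∀ p ∈ D, (f p).det ≠ 0 ∧ NonScalar (qmat (f p))) ∧
    M = {x | ∀ p ∈ D, MrelC (qmat (f p)) (x p.1) (x p.2)}

/-! ### The two-sorted space `ℂⁿ × Y(1)ⁿ`, broadness, freeness, (EC) -/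

/-- The coordinate projection `Pr_i : ℂⁿ × Y(1)ⁿ → ℂ^ℓ × Y(1)^ℓ` attached to a tuple
`i₁ < ⋯ < i_ℓ`. -/
def prSum {n ℓ : ℕ} (i : Fin ℓ → Fin n) (v : (Fin n ⊕ Fin n) → ℂ) : (Fin ℓ ⊕ Fin ℓ) → ℂ :=
  Sum.elim (fun k => v (Sum.inl (i k))) (fun k => v (Sum.inr (i k)))

/-- `V ⊆ ℂⁿ × Y(1)ⁿ` is broad: `dim Pr_i(V) ≥ ℓ` for every tuple `i₁ < ⋯ < i_ℓ`. -/
def Broad {n : ℕ} (V : Set ((Fin n ⊕ Fin n) → ℂ)) : Prop :=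
  ∀ (ℓ : ℕ) (i : Fin ℓ → Fin n), 1 ≤ ℓ → StrictMono i → ℓ ≤ adim (prSum i '' V)

/-- `V ⊆ ℂⁿ × Y(1)ⁿ` is modularly free: `V` is not contained in `ℂⁿ × T` for any proper
special subvariety `T` of `Y(1)ⁿ`. -/
def ModularlyFree {n : ℕ} (j : ℂ → ℂ) (V : Set ((Fin n ⊕ Fin n) → ℂ)) : Prop :=
  ∀ T : Set (Fin n → ℂ), IsSpecial j T → T ≠ Set.univ →
    ¬ V ⊆ {v | (fun k => v (Sum.inr k)) ∈ T}

/-- `V ⊆ ℂⁿ × Y(1)ⁿ` is free. -/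
def Free {n : ℕ} (j : ℂ → ℂ) (V : Set ((Fin n ⊕ Fin n) → ℂ)) : Prop :=
  NoConstCoord V ∧
  (∀ M : Set (Fin n → ℂ), IsMoebiusQpos M → M ≠ Set.univ →
    ¬ V ⊆ {v | (fun k => v (Sum.inl k)) ∈ M}) ∧
  ModularlyFree j V

/-- The graph `E_jⁿ ⊆ ℂⁿ × Y(1)ⁿ` of the `j`-function. -/
def Ej (j : ℂ → ℂ) (n : ℕ) : Set ((Fin n ⊕ Fin n) → ℂ) :=
  {v | (∀ k, v (Sum.inl k) ∈ HH) ∧ ∀ k, v (Sum.inr k) = j (v (Sum.inl k))}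

/-- `V` satisfies (EC): `V ∩ E_jⁿ` is Zariski dense in `V`. -/
def SatisfiesEC {n : ℕ} (j : ℂ → ℂ) (V : Set ((Fin n ⊕ Fin n) → ℂ)) : Prop :=
  V ⊆ zcl (V ∩ Ej j n)

/-! ### MSCD and MZP -/

/-- The modular Schanuel conjecture with derivatives. -/
def MSCD (j : ℂ → ℂ) : Prop :=
  ∀ (n : ℕ) (z : Fin n → ℂ), (∀ i, z i ∈ HH) →
    3 * dimG z SigmaSet ≤
      trdegF ⊥ (fun p : Fin 4 × Fin n =>
        ![z, j ∘ z, deriv j ∘ z, deriv (deriv j) ∘ z] p.1 p.2)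

/-- `X` is an atypical component of `W ⊆ Y(1)ⁿ`: an irreducible component of `W ∩ T`,
for some special subvariety `T`, with `dim X > dim W + dim T − n`. -/
def IsAtypComp {n : ℕ} (j : ℂ → ℂ) (W X : Set (Fin n → ℂ)) : Prop :=
  ∃ T, IsSpecial j T ∧ IsIrrCompOf X (W ∩ T) ∧
    (adim W : ℤ) + (adim T : ℤ) - (n : ℤ) < (adim X : ℤ)

/-- The modular Zilber–Pink conjecture: every subvariety of `Y(1)ⁿ` has finitely many
maximal atypical components. -/
def MZP (j : ℂ → ℂ) : Prop :=
  ∀ (n : ℕ) (W : Set (Fin n → ℂ)), IsAlgSet W →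
    {X | IsAtypComp j W X ∧ ∀ X', IsAtypComp j W X' → X ⊆ X' → X = X'}.Finite

/-! ### `j`-derivations, `jcl`, `C_j`, `dim^j` -/

/-- A `j`-derivation on `ℂ`. -/
def IsJDeriv (j : ℂ → ℂ) (D : ℂ → ℂ) : Prop :=
  (∀ a b : ℂ, D (a + b) = D a + D b) ∧
  (∀ a b : ℂ, D (a * b) = a * D b + b * D a) ∧
  (∀ z ∈ HH, ∀ k : ℕ, D (deriv^[k] j z) = deriv^[k + 1] j z * D z)

/-- The `j`-closure of a subset of `ℂ`. -/
def jcl (j : ℂ → ℂ) (A : Set ℂ) : Set ℂ :=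
  {x | ∀ D : ℂ → ℂ, IsJDeriv j D → (∀ a ∈ A, D a = 0) → D x = 0}

/-- `C_j = jcl(∅)`. -/
def Cj (j : ℂ → ℂ) : Set ℂ := jcl j ∅

/-- `dim^j(A|B) ≥ n`. -/
def dimjGE (j : ℂ → ℂ) (A B : Set ℂ) (n : ℕ) : Prop :=
  ∃ (a : Fin n → ℂ) (D : Fin n → ℂ → ℂ),
    (∀ i, a i ∈ jcl j A) ∧
    (∀ i, IsJDeriv j (D i) ∧ ∀ b ∈ B, D i b = 0) ∧
    (∀ i k, D i (a k) = if i = k then 1 else 0)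

/-- `dim^j(A|B)`, the relative dimension in the pregeometry `jcl`. -/
def dimj (j : ℂ → ℂ) (A B : Set ℂ) : ℕ := sSup {n | dimjGE j A B n}

/-- `V ⊆ ℂⁿ × Y(1)ⁿ` (broad) has no `C_j`-factors. -/
def NoCjFactors {n : ℕ} (j : ℂ → ℂ) (V : Set ((Fin n ⊕ Fin n) → ℂ)) : Prop :=
  ∀ (ℓ : ℕ) (i : Fin ℓ → Fin n), 1 ≤ ℓ → StrictMono i →
    ℓ < adim (prSum i '' V) ∨
    (adim (prSum i '' V) = ℓ ∧ ¬ IsAlgSetOver (Cj j) (zcl (prSum i '' V)))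

/-- A tuple `t ∈ ℍ^m` is convenient for `j`:
`tr.deg_ℚ ℚ(t, J(t)) = 3 dim_G(t|Σ) + dim^j(t)`. -/
def ConvenientTuple (j : ℂ → ℂ) {m : ℕ} (t : Fin m → ℂ) : Prop :=
  (∀ i, t i ∈ HH) ∧
  trdegF ⊥ (fun p : Fin 4 × Fin m =>
      ![t, j ∘ t, deriv j ∘ t, deriv (deriv j) ∘ t] p.1 p.2)
    = 3 * dimG t SigmaSet + dimj j (Set.range t) ∅

/-! ### Iterates of `j` -/

/-- The iterates of `j`: `jIt j 0 = id`, `jIt j (n+1) = j ∘ jIt j n`; so `j_n = jIt j n`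
for `n ≥ 1`. -/
def jIt (j : ℂ → ℂ) : ℕ → ℂ → ℂ
  | 0 => id
  | n + 1 => j ∘ jIt j n

/-- The domain `ℍ_n` of `j_n`: `ℍ₁ = ℍ`, `ℍ_{n+1} = {z ∈ ℍ_n : j_n(z) ∈ ℍ}`. -/
def HHn (j : ℂ → ℂ) : ℕ → Set ℂ
  | 0 => Set.univ
  | n + 1 => {z ∈ HHn j n | jIt j n z ∈ HH}

/-! ### The space `ℂⁿ × Y₂(1)ⁿ` with derivatives -/

/-- The projection `PR_i : ℂⁿ × Y₂(1)ⁿ → ℂ^ℓ × Y₂(1)^ℓ`. -/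
def prJ {n ℓ : ℕ} (i : Fin ℓ → Fin n) (v : (Fin n ⊕ Fin n × Fin 3) → ℂ) :
    (Fin ℓ ⊕ Fin ℓ × Fin 3) → ℂ :=
  Sum.elim (fun k => v (Sum.inl (i k))) (fun p => v (Sum.inr (i p.1, p.2)))

/-- `V ⊆ ℂⁿ × Y₂(1)ⁿ` is `J`-broad: `dim PR_i(V) ≥ 3ℓ` for all `i`. -/
def JBroad {n : ℕ} (V : Set ((Fin n ⊕ Fin n × Fin 3) → ℂ)) : Prop :=
  ∀ (ℓ : ℕ) (i : Fin ℓ → Fin n), 1 ≤ ℓ → StrictMono i → 3 * ℓ ≤ adim (prJ i '' V)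

/-- `V ⊆ ℂⁿ × Y₂(1)ⁿ` is `J`-free. -/
def JFree {n : ℕ} (j : ℂ → ℂ) (V : Set ((Fin n ⊕ Fin n × Fin 3) → ℂ)) : Prop :=
  NoConstCoord V ∧
  (∀ M : Set (Fin n → ℂ), IsMoebiusRat M → M ≠ Set.univ →
    ¬ V ⊆ {v | (fun k => v (Sum.inl k)) ∈ M}) ∧
  (∀ T : Set (Fin n → ℂ), IsSpecial j T → T ≠ Set.univ →
    ¬ V ⊆ {v | (fun k => v (Sum.inr (k, 0))) ∈ T})

/-- The graph `E_Jⁿ ⊆ ℂⁿ × Y₂(1)ⁿ` of `J = (j, j′, j″)`. -/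
def EJ (j : ℂ → ℂ) (n : ℕ) : Set ((Fin n ⊕ Fin n × Fin 3) → ℂ) :=
  {v | (∀ k, v (Sum.inl k) ∈ HH) ∧ ∀ k : Fin n,
      v (Sum.inr (k, 0)) = j (v (Sum.inl k)) ∧
      v (Sum.inr (k, 1)) = deriv j (v (Sum.inl k)) ∧
      v (Sum.inr (k, 2)) = deriv (deriv j) (v (Sum.inl k))}

/-- `V ⊆ ℂⁿ × Y₂(1)ⁿ` (J-broad) has no `C_j`-factors. -/
def NoCjFactorsJ {n : ℕ} (j : ℂ → ℂ) (V : Set ((Fin n ⊕ Fin n × Fin 3) → ℂ)) : Prop :=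
  ∀ (ℓ : ℕ) (i : Fin ℓ → Fin n), 1 ≤ ℓ → StrictMono i →
    3 * ℓ < adim (prJ i '' V) ∨
    (adim (prJ i '' V) = 3 * ℓ ∧ ¬ IsAlgSetOver (Cj j) (zcl (prJ i '' V)))

/-! ### Irreducible components -/

section Components

open MvPolynomial

variable {ι : Type*}

theorem isAlgSet_zeroLocus (I : Ideal (MvPolynomial ι ℂ)) : IsAlgSet (zeroLocus ℂ I) :=
  ⟨I, by ext x; simp [aeval_eq_eval]⟩

theorem IsAlgSet.zeroLocus_vanishingIdeal {V : Set (ι → ℂ)} (hV : IsAlgSet V) :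
    zeroLocus ℂ (vanishingIdeal ℂ V) = V := by
  obtain ⟨P, rfl⟩ := hV
  refine le_antisymm (fun x hx p hp => ?_) fun x hx p hp => hp x hx
  have := hx p fun y hy => by simpa [aeval_eq_eval] using hy p hp
  simpa [aeval_eq_eval] using this

theorem IsIrr.isPrime_vanishingIdeal {V : Set (ι → ℂ)} (hV : IsIrr V) :
    (vanishingIdeal ℂ V).IsPrime := by
  refine ⟨fun h => ?_, fun {p q} hpq => ?_⟩
  · obtain ⟨x, hx⟩ := hV.1
    have h1 : (1 : MvPolynomial ι ℂ) ∈ vanishingIdeal ℂ V := h ▸ Submodule.mem_top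
    simpa using h1 x hx
  · have key := hV.2 {x | eval x p = 0} {x | eval x q = 0} ⟨{p}, by simp⟩ ⟨{q}, by simp⟩
      fun x hx => by simpa [aeval_eq_eval] using hpq x hx
    refine key.imp (fun h x hx => ?_) fun h x hx => ?_ <;>
    simpa [aeval_eq_eval] using h hx

theorem isIrr_zeroLocus [Finite ι] (I : Ideal (MvPolynomial ι ℂ)) [hI : I.IsPrime] :
    IsIrr (zeroLocus ℂ I) := by
  have hv : vanishingIdeal ℂ (zeroLocus ℂ I) = I := IsPrime.vanishingIdeal_zeroLocus I
  refine ⟨?_, fun V W hV hW hVW => ?_⟩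
  · by_contra h
    rw [Set.not_nonempty_iff_eq_empty] at h
    rw [h, vanishingIdeal_empty] at hv
    exact hI.ne_top hv.symm
  · have h1 : vanishingIdeal ℂ V * vanishingIdeal ℂ W ≤ I := by
      rw [Ideal.mul_le, ← hv]
      intro p hp q hq x hx
      rcases hVW hx with h | h
      · rw [map_mul, hp x h, zero_mul]
      · rw [map_mul, hq x h, mul_zero]
    rw [← hV.zeroLocus_vanishingIdeal, ← hW.zeroLocus_vanishingIdeal]
    exact (hI.mul_le.1 h1).imp (fun h => zeroLocus_anti_mono h) fun h => zeroLocus_anti_mono h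

theorem finite_irrCompOf [Finite ι] (A : Set (ι → ℂ)) : {T | IsIrrCompOf T A}.Finite := by
  refine Set.Finite.of_finite_image (f := vanishingIdeal ℂ)
    ((Ideal.finite_minimalPrimes_of_isNoetherianRing _ (vanishingIdeal ℂ A)).subset ?_) ?_
  · rintro _ ⟨T, ⟨hT, hirr, hTA, hmax⟩, rfl⟩
    have hA : vanishingIdeal ℂ A ≤ vanishingIdeal ℂ T := by
      have h1 : zcl A ⊆ zeroLocus ℂ (vanishingIdeal ℂ A) :=
        Set.sInter_subset_of_mem ⟨isAlgSet_zeroLocus _, fun x hx p hp => hp x hx⟩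
      exact fun p hp x hx => h1 (hTA hx) p hp
    refine ⟨⟨hirr.isPrime_vanishingIdeal, hA⟩, fun P hP hPT => ?_⟩
    have := hP.1
    have h2 : T = zeroLocus ℂ P := by
      refine hmax _ (isAlgSet_zeroLocus P) (isIrr_zeroLocus P) ?_ ?_
      · refine Set.subset_sInter fun V hV => ?_
        rw [← hV.1.zeroLocus_vanishingIdeal]
        exact zeroLocus_anti_mono ((vanishingIdeal_anti_mono hV.2).trans hP.2)
      · rw [← hT.zeroLocus_vanishingIdeal]
        exact zeroLocus_anti_mono hPT
    rw [h2, IsPrime.vanishingIdeal_zeroLocus]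
  · intro T hT T' hT' h
    rw [← hT.1.zeroLocus_vanishingIdeal, ← hT'.1.zeroLocus_vanishingIdeal]
    exact congrArg _ h

theorem IsIrrCompOf.subset_of_isAlgSet {T A V : Set (ι → ℂ)} (hT : IsIrrCompOf T A)
    (hV : IsAlgSet V) (hA : A ⊆ V) : T ⊆ V :=
  hT.2.2.1.trans (Set.sInter_subset_of_mem ⟨hV, hA⟩)

theorem IsIrrCompOf.not_noConstCoord {T A : Set (ι → ℂ)} (hT : IsIrrCompOf T A) (i : ι)
    {s : Set ℂ} (hs : s.Finite) (hA : ∀ y ∈ A, y i ∈ s) : ¬ NoConstCoord T := by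
  have key : ∀ s : Finset ℂ, (∀ y ∈ T, y i ∈ s) → ∃ c, ∀ y ∈ T, y i = c := by
    intro s
    induction s using Finset.induction_on with
    | empty => intro h; exact ⟨0, fun y hy => absurd (h y hy) (Finset.notMem_empty _)⟩
    | insert a s ha ih =>
      intro h
      have := hT.2.1.2 {y | y i = a} {y | ∀ p ∈ ({∏ c ∈ s, (X i - C c)} : Set (MvPolynomial ι ℂ)),
        eval y p = 0} ⟨{X i - C a}, by ext; simp [sub_eq_zero]⟩ ⟨_, rfl⟩ fun y hy => by
          simpa [Finset.prod_eq_zero_iff, sub_eq_zero, eval_prod] using h y hy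
      rcases this with h1 | h1
      · exact ⟨a, h1⟩
      · refine ih fun y hy => ?_
        simpa [Finset.prod_eq_zero_iff, sub_eq_zero, eval_prod] using h1 hy
  intro hnc
  obtain ⟨c, hc⟩ := key hs.toFinset fun y hy => by
    have := hT.subset_of_isAlgSet (V := {y | ∀ p ∈ ({∏ c ∈ hs.toFinset, (X i - C c)} :
      Set (MvPolynomial ι ℂ)), eval y p = 0}) ⟨_, rfl⟩ (fun y hy => by
        simpa [Finset.prod_eq_zero_iff, sub_eq_zero, eval_prod] using hA y hy) hy
    simpa [Finset.prod_eq_zero_iff, sub_eq_zero, eval_prod] using this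
  obtain ⟨v, hv, hvc⟩ := hnc i c
  exact hvc (hc v hv)

end Components

/-! ### Integer matrices acting on the upper half-plane -/

section Matrices

open UpperHalfPlane ModularGroup
open scoped MatrixGroups Modular

theorem denom_ne_zero_of_mem_HH {g : Matrix (Fin 2) (Fin 2) ℤ} (hg : g.det ≠ 0) {z : ℂ}
    (hz : z ∈ HH) : (g 1 0 : ℂ) * z + g 1 1 ≠ 0 := by
  intro h
  have him := congrArg Complex.im h
  have hre := congrArg Complex.re h
  have hz' : z.im ≠ 0 := ne_of_gt hz
  simp [hz'] at him
  simp [him] at hre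
  exact hg (by simp [Matrix.det_fin_two, him, hre])

theorem moeb_zmat (g : Matrix (Fin 2) (Fin 2) ℤ) (z : ℂ) :
    moeb (zmat g) z = (g 0 0 * z + g 0 1) / (g 1 0 * z + g 1 1) := rfl

theorem moeb_zmat_mul (h : Matrix (Fin 2) (Fin 2) ℤ) {g : Matrix (Fin 2) (Fin 2) ℤ}
    (hg : g.det ≠ 0) {z : ℂ} (hz : z ∈ HH) :
    moeb (zmat (h * g)) z = moeb (zmat h) (moeb (zmat g) z) := by
  have hd := denom_ne_zero_of_mem_HH hg hz
  simp only [moeb_zmat, Matrix.mul_apply, Fin.sum_univ_two]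
  rw [eq_comm, ← mul_div_mul_right _ _ hd, add_mul, add_mul, mul_assoc, mul_assoc,
    div_mul_cancel₀ _ hd]
  push_cast
  congr 1 <;> ring

theorem moeb_zmat_mem_HH {g : Matrix (Fin 2) (Fin 2) ℤ} (hg : 0 < g.det) {z : ℂ}
    (hz : z ∈ HH) : moeb (zmat g) z ∈ HH := by
  have hd := denom_ne_zero_of_mem_HH hg.ne' hz
  have hn := Complex.normSq_pos.2 hd
  have hg' : (0 : ℝ) < g 0 0 * g 1 1 - g 0 1 * g 1 0 := by
    rw [Matrix.det_fin_two] at hg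
    exact_mod_cast hg
  have hz' : 0 < z.im := hz
  have : (moeb (zmat g) z).im = (g 0 0 * g 1 1 - g 0 1 * g 1 0) * z.im /
      Complex.normSq ((g 1 0 : ℂ) * z + g 1 1) := by
    rw [moeb_zmat, Complex.div_im, div_sub_div_same]
    congr 1
    simp
    ring
  show 0 < (moeb (zmat g) z).im
  rw [this]
  positivity

theorem moeb_zmat_scalar {a : ℤ} (ha : a ≠ 0) (z : ℂ) :
    moeb (zmat (a • (1 : Matrix (Fin 2) (Fin 2) ℤ))) z = z := by
  have : (a : ℂ) ≠ 0 := by exact_mod_cast ha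
  simp only [moeb_zmat, Matrix.smul_apply, Matrix.one_apply]
  simp [this]

theorem coe_smul_eq_moeb (γ : SL(2, ℤ)) (τ : ℍ) :
    ((γ • τ : ℍ) : ℂ) = moeb (zmat (γ : Matrix (Fin 2) (Fin 2) ℤ)) τ := by
  rw [UpperHalfPlane.coe_specialLinearGroup_apply, moeb_zmat]
  simp

theorem finite_fixedPoints_fd (D : ℤ) (hD : 0 < D) :
    {τ : ℍ | τ ∈ 𝒟 ∧ ∃ B : Matrix (Fin 2) (Fin 2) ℤ, B.det = D ∧ (∀ a : ℤ, B ≠ a • (1 : Matrix (Fin 2) (Fin 2) ℤ)) ∧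
      moeb (zmat B) τ = τ}.Finite := by
  let box : Set (ℤ × ℤ × ℤ × ℤ) :=
    Set.Icc (-(10 * D ^ 2)) (10 * D ^ 2) ×ˢ Set.Icc (-(10 * D ^ 2)) (10 * D ^ 2) ×ˢ
      Set.Icc (-(10 * D ^ 2)) (10 * D ^ 2) ×ˢ Set.Icc (-(10 * D ^ 2)) (10 * D ^ 2)
  have hbox : box.Finite := by
    refine Set.Finite.prod ?_ (Set.Finite.prod ?_ (Set.Finite.prod ?_ ?_)) <;>
      exact Set.finite_Icc _ _
  let fixes : ℤ × ℤ × ℤ × ℤ → Set ℍ := fun p => {τ | p.2.2.1 ≠ 0 ∧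
    2 * (p.2.2.1 : ℝ) * τ.re = p.1 - p.2.2.2 ∧
      (p.2.2.1 * τ.re + p.2.2.2) ^ 2 + (p.2.2.1 : ℝ) ^ 2 * τ.im ^ 2 = D}
  refine (hbox.biUnion (t := fixes) fun p _ => Set.Subsingleton.finite ?_).subset ?_
  · rintro τ ⟨hc, hx, hy⟩ τ' ⟨-, hx', hy'⟩
    have hc' : (p.2.2.1 : ℝ) ≠ 0 := by exact_mod_cast hc
    have hre : τ.re = τ'.re := by
      have := hx.trans hx'.symm
      exact mul_left_cancel₀ (mul_ne_zero two_ne_zero hc') this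
    have him : τ.im = τ'.im := by
      rw [hre] at hy
      have h1 : τ.im ^ 2 = τ'.im ^ 2 :=
        mul_left_cancel₀ (pow_ne_zero 2 hc') (by linarith)
      exact (pow_left_inj₀ τ.im_pos.le τ'.im_pos.le two_ne_zero).1 h1
    exact UpperHalfPlane.ext (Complex.ext hre him)
  · rintro τ ⟨hτ, B, hdet, hns, hfix⟩
    have hd := denom_ne_zero_of_mem_HH (hdet.trans_ne hD.ne') τ.im_pos
    rw [moeb_zmat, div_eq_iff hd] at hfix
    have him := congrArg Complex.im hfix
    have hre := congrArg Complex.re hfix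
    have hy := τ.im_pos
    simp at him hre
    have h3 := three_le_four_mul_im_sq_of_mem_fd hτ
    have hx2 := abs_le.1 hτ.2
    rw [Matrix.det_fin_two] at hdet
    have hdet' : (B 0 0 * B 1 1 - B 0 1 * B 1 0 : ℝ) = D := by exact_mod_cast hdet
    generalize hx : τ.re = x at *
    generalize hyy : τ.im = y at *
    have e1 : 2 * (B 1 0 : ℝ) * x = B 0 0 - B 1 1 := by
      have : y * (2 * (B 1 0 : ℝ) * x) = y * (B 0 0 - B 1 1) := by linarith
      exact mul_left_cancel₀ hy.ne' this
    have e2 : ((B 1 0 : ℝ) * x + B 1 1) ^ 2 + (B 1 0 : ℝ) ^ 2 * y ^ 2 = D := by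
      have e1' : (B 0 0 : ℝ) = 2 * B 1 0 * x + B 1 1 := by linarith
      rw [e1'] at hre hdet'
      linear_combination hdet' + B 1 0 * hre
    have hDr : (1 : ℝ) ≤ D := by exact_mod_cast hD
    have hc0 : B 1 0 ≠ 0 := by
      intro hc
      simp only [hc, Int.cast_zero, mul_zero, zero_mul] at e1 hre
      have e3 : B 0 0 = B 1 1 := by
        have : (B 0 0 : ℝ) = B 1 1 := by linarith
        exact_mod_cast this
      have e4 : B 0 1 = 0 := by
        rw [e3] at hre
        have : (B 0 1 : ℝ) = 0 := by linarith
        exact_mod_cast this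
      refine hns (B 1 1) ?_
      ext i k
      fin_cases i <;> fin_cases k <;> simp [hc, e3, e4]
    have hcD : (B 1 0 : ℝ) ^ 2 ≤ 2 * D := by nlinarith [sq_nonneg ((B 1 0 : ℝ) * x + B 1 1)]
    have hcb : |(B 1 0 : ℝ)| ≤ 2 * D := abs_le_of_sq_le_sq (by nlinarith) (by linarith)
    have hw : |(B 1 0 : ℝ) * x + B 1 1| ≤ D := abs_le_of_sq_le_sq (by nlinarith) (by linarith)
    have hcx : |(B 1 0 : ℝ) * x| ≤ D := by
      rw [abs_mul]
      have : |x| ≤ 1 / 2 := abs_le.2 hx2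
      nlinarith [abs_nonneg x, abs_nonneg (B 1 0 : ℝ)]
    rw [abs_le] at hw hcx hcb
    have hd2 : |(B 1 1 : ℝ)| ≤ 2 * D := abs_le.2 ⟨by linarith, by linarith⟩
    have ha2 : |(B 0 0 : ℝ)| ≤ 4 * D := by
      rw [abs_le] at hd2 ⊢
      constructor <;> linarith
    have hb : |(B 0 1 : ℝ)| ≤ 10 * D ^ 2 := by
      have h1 : (1 : ℝ) ≤ |(B 1 0 : ℝ)| := by exact_mod_cast Int.one_le_abs hc0
      have h2 : |(B 0 1 : ℝ)| * |(B 1 0 : ℝ)| ≤ |(B 0 0 : ℝ)| * |(B 1 1 : ℝ)| + D := by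
        rw [← abs_mul, ← abs_mul]
        have : (B 0 1 * B 1 0 : ℝ) = B 0 0 * B 1 1 - D := by linarith
        rw [this]
        refine (abs_sub _ _).trans ?_
        rw [abs_of_nonneg (by linarith : (0 : ℝ) ≤ D)]
      have h3 : |(B 0 0 : ℝ)| * |(B 1 1 : ℝ)| ≤ 4 * D * (2 * D) :=
        mul_le_mul ha2 hd2 (abs_nonneg _) (by linarith)
      nlinarith [abs_nonneg (B 0 1 : ℝ)]
    have hDD : (D : ℝ) ≤ D ^ 2 := by nlinarith
    refine Set.mem_biUnion (x := (B 0 0, B 0 1, B 1 0, B 1 1)) ?_ ⟨hc0, ?_, ?_⟩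
    · have key : ∀ t : ℤ, |(t : ℝ)| ≤ 10 * D ^ 2 → t ∈ Set.Icc (-(10 * D ^ 2)) (10 * D ^ 2) := by
        intro t ht
        rw [abs_le] at ht
        exact ⟨by exact_mod_cast ht.1, by exact_mod_cast ht.2⟩
      exact ⟨key _ (by linarith), key _ hb, key _ (by rw [abs_le]; constructor <;> nlinarith),
        key _ (by linarith)⟩
    · rw [hx]; exact e1
    · rw [hx, hyy]; exact e2

theorem dvd_of_dvd_mul_primitive {g : Matrix (Fin 2) (Fin 2) ℤ}
    (hg : Nat.gcd (Int.gcd (g 0 0) (g 0 1)) (Int.gcd (g 1 0) (g 1 1)) = 1) {a N : ℤ}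
    (h : ∀ i k, a ∣ N * g i k) : a ∣ N := by
  have key : ∀ s t : ℤ, a ∣ N * s → a ∣ N * t → a ∣ N * (Int.gcd s t : ℤ) := fun s t hs ht => by
    rw [Int.gcd_eq_gcd_ab, mul_add, ← mul_assoc, ← mul_assoc]
    exact dvd_add (hs.mul_right _) (ht.mul_right _)
  have h1 := key _ _ (key _ _ (h 0 0) (h 0 1)) (key _ _ (h 1 0) (h 1 1))
  rw [Int.gcd_natCast_natCast, hg] at h1
  simpa using h1

theorem IsModularJ.apply_smul {j : ℂ → ℂ} (hj : IsModularJ j) (γ : SL(2, ℤ)) (τ : ℍ) :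
    j (γ • τ : ℍ) = j τ := by
  rw [coe_smul_eq_moeb]
  exact hj.invariant _ γ.2 _ τ.im_pos

theorem finite_inter_phiRel {j : ℂ → ℂ} (hj : IsModularJ j)
    (hinj : ∀ z w : ℍ, j z = j w → ∃ γ : SL(2, ℤ), γ • z = w) {M N : ℕ} (hM : 1 ≤ M)
    (hN : 1 ≤ N) (hMN : M ≠ N) : {x | ∃ y, PhiRel j M x y ∧ PhiRel j N x y}.Finite := by
  have hD : (0 : ℤ) < N * M := by positivity
  refine ((finite_fixedPoints_fd _ hD).image fun τ : ℍ => j τ).subset ?_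
  rintro _ ⟨y, ⟨z, hz, g, hg, hgp, rfl, hgy⟩, ⟨z', hz', h, hh, hhp, hzz, hhy⟩⟩
  have hg0 : 0 < g.det := by omega
  have hh0 : 0 < h.det := by omega
  obtain ⟨ε, hε⟩ := exists_smul_mem_fd ⟨z, hz⟩
  set τ : ℍ := ε • ⟨z, hz⟩ with hτ
  have hz1 : (ε⁻¹ • τ : ℍ) = ⟨z, hz⟩ := inv_smul_smul _ _
  have hz2 : z = moeb (zmat (ε⁻¹ : SL(2, ℤ)).1) τ := by rw [← coe_smul_eq_moeb, hz1]
  have hjz : j τ = j z := by rw [hτ, hj.apply_smul]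
  obtain ⟨γ, hγ⟩ := hinj τ ⟨z', hz'⟩ (hjz.trans hzz)
  have hz3 : z' = moeb (zmat γ.1) τ := by rw [← coe_smul_eq_moeb, hγ]
  obtain ⟨δ, hδ⟩ := hinj ⟨_, moeb_zmat_mem_HH hg0 hz⟩ ⟨_, moeb_zmat_mem_HH hh0 hz'⟩
    (hgy.symm.trans hhy)
  have hδ' : moeb (zmat δ.1) (moeb (zmat g) z) = moeb (zmat h) z' := by
    have := congrArg UpperHalfPlane.coe hδ
    rwa [coe_smul_eq_moeb] at this
  have hτH : (τ : ℂ) ∈ HH := τ.im_pos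
  have hε1 : (ε⁻¹ : SL(2, ℤ)).1.det = 1 := (ε⁻¹).2
  have hγ1 : γ.1.det = 1 := γ.2
  have hδ1 : δ.1.det = 1 := δ.2
  have hdet1 : (g * (ε⁻¹ : SL(2, ℤ)).1).det = M := by rw [Matrix.det_mul, hε1, hg, mul_one]
  have hdet2 : (h * γ.1).det = N := by rw [Matrix.det_mul, hγ1, hh, mul_one]
  have hdet1' : (δ.1 * (g * (ε⁻¹ : SL(2, ℤ)).1)).det = M := by
    rw [Matrix.det_mul, hδ1, hdet1, one_mul]
  have hfix : moeb (zmat (δ.1 * (g * (ε⁻¹ : SL(2, ℤ)).1))) τ = moeb (zmat (h * γ.1)) τ := by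
    rw [moeb_zmat_mul _ (by omega) hτH, moeb_zmat_mul _ (by omega) hτH,
      moeb_zmat_mul _ (by omega) hτH, ← hz2, ← hz3, hδ']
  set A := δ.1 * (g * (ε⁻¹ : SL(2, ℤ)).1) with hA
  set H := h * γ.1 with hH
  refine ⟨τ, ⟨hε, H.adjugate * A, ?_, fun a ha => ?_, ?_⟩, hjz⟩
  · rw [Matrix.det_mul, Matrix.det_adjugate, hdet1', hdet2]
    simp
  · have h1 : (N : ℤ) • A = a • H := by
      have := congrArg (H * ·) ha
      rwa [← mul_assoc, Matrix.mul_adjugate, hdet2, Matrix.smul_mul, one_mul, Matrix.mul_smul,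
        mul_one] at this
    have h2 : (N : ℤ) • g = a • ((δ⁻¹ : SL(2, ℤ)).1 * H * ε.1) := by
      have h3 : g = (δ⁻¹ : SL(2, ℤ)).1 * A * ε.1 := by
        have e1 : (δ⁻¹ : SL(2, ℤ)).1 * δ.1 = 1 := by
          rw [← Matrix.SpecialLinearGroup.coe_mul]; simp
        have e2 : (ε⁻¹ : SL(2, ℤ)).1 * ε.1 = 1 := by
          rw [← Matrix.SpecialLinearGroup.coe_mul]; simp
        rw [hA, ← mul_assoc, e1, one_mul, mul_assoc, e2, mul_one]
      conv_lhs => rw [h3]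
      rw [← Matrix.smul_mul, ← Matrix.mul_smul, h1, Matrix.mul_smul, Matrix.smul_mul]
    have h3 : a • h = (N : ℤ) • (A * (γ⁻¹ : SL(2, ℤ)).1) := by
      have e1 : γ.1 * (γ⁻¹ : SL(2, ℤ)).1 = 1 := by
        rw [← Matrix.SpecialLinearGroup.coe_mul]; simp
      rw [← Matrix.smul_mul, h1, Matrix.smul_mul, hH, mul_assoc, e1, mul_one]
    have h4 : a ∣ N := dvd_of_dvd_mul_primitive hgp fun i k =>
      ⟨_, congrFun (congrFun h2 i) k⟩
    have h5 : (N : ℤ) ∣ a := dvd_of_dvd_mul_primitive hhp fun i k =>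
      ⟨_, congrFun (congrFun h3 i) k⟩
    have h6 : a.natAbs = N := by
      simpa using Int.natAbs_eq_of_dvd_dvd h4 h5
    have h7 := congrArg Matrix.det h1
    rw [Matrix.det_smul, Matrix.det_smul, hdet1', hdet2, Fintype.card_fin, ← Int.natAbs_sq a,
      h6] at h7
    have h8 : (N : ℤ) ^ 2 ≠ 0 := by positivity
    exact hMN (by exact_mod_cast mul_left_cancel₀ h8 h7)
  · have hHH := moeb_zmat_mem_HH (g := H) (by omega) hτH
    rw [moeb_zmat_mul _ (by omega) hτH, hfix, ← moeb_zmat_mul _ (by omega) hτH,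
      Matrix.adjugate_mul, hdet2, moeb_zmat_scalar (by omega)]

end Matrices

/-! ### The modular function separates the orbits of the modular group -/

section Injectivity

open UpperHalfPlane ModularGroup Filter Topology
open scoped MatrixGroups Modular

variable {j : ℂ → ℂ}

theorem IsModularJ.exists_lipschitz_qExpansion (hj : IsModularJ j) :
    ∃ (h : ℂ → ℂ) (K : NNReal) (t : Set ℂ), t ∈ 𝓝 0 ∧ LipschitzOnWith K h t ∧
      ∀ τ : ℍ, j τ = (Function.Periodic.qParam 1 τ)⁻¹ + 744 + h (Function.Periodic.qParam 1 τ) := by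
  obtain ⟨a, ha⟩ := hj.fourier
  have hq : ∀ z : ℂ, Complex.exp (2 * (Real.pi : ℂ) * Complex.I * z) =
      Function.Periodic.qParam 1 z := fun z => by simp [Function.Periodic.qParam]
  simp only [hq] at ha
  set r : ℝ := ‖Function.Periodic.qParam 1 I‖ with hr
  have hr0 : 0 < r := norm_pos_iff.2 (Function.Periodic.qParam_ne_zero _)
  have hd : DifferentiableOn ℂ (fun w => ∑' k : ℕ, a k * w ^ (k + 1)) (Metric.ball 0 r) := by
    refine Complex.differentiableOn_tsum_of_summable_norm (ha I I.im_pos).summable.norm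
      (fun k => by fun_prop) Metric.isOpen_ball fun k w hw => ?_
    rw [norm_mul, norm_mul, norm_pow, norm_pow]
    gcongr
    exact (mem_ball_zero_iff.1 hw).le
  have hc := (hd.contDiffOn (n := 1) Metric.isOpen_ball).contDiffAt
    (Metric.isOpen_ball.mem_nhds (Metric.mem_ball_self hr0))
  obtain ⟨K, t, ht, hK⟩ := hc.exists_lipschitzOnWith
  refine ⟨_, K, t, ht, hK, fun τ => ?_⟩
  rw [(ha τ τ.im_pos).tsum_eq]
  ring

theorem IsModularJ.exists_norm_gt (hj : IsModularJ j) (M : ℝ) :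
    ∃ Y : ℝ, ∀ τ : ℍ, Y ≤ τ.im → M < ‖j τ‖ := by
  obtain ⟨h, K, t, ht, hK, hh⟩ := hj.exists_lipschitz_qExpansion
  have hq := Function.Periodic.qParam_tendsto one_pos
  have h1 := (tendsto_norm_inv_nhdsNE_zero_atTop (α := ℂ)).comp hq
  have h2 : Tendsto (fun z => ‖744 + h (Function.Periodic.qParam 1 z)‖) (comap Complex.im atTop)
      (𝓝 ‖744 + h 0‖) :=
    (((hK.continuousOn.continuousAt ht).tendsto.comp
      (hq.mono_right nhdsWithin_le_nhds)).const_add 744).norm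
  obtain ⟨Y, -, hY⟩ := (atTop_basis.comap Complex.im).eventually_iff.1
    ((h1.eventually_gt_atTop (M + (‖744 + h 0‖ + 1))).and (h2.eventually_lt_const (lt_add_one _)))
  refine ⟨Y, fun τ hτ => ?_⟩
  obtain ⟨h3, h4⟩ := hY hτ
  rw [hh, add_assoc]
  have := norm_sub_le_norm_add (Function.Periodic.qParam 1 (τ : ℂ))⁻¹
    (744 + h (Function.Periodic.qParam 1 τ))
  simp only [Function.comp_apply] at h3
  linarith

theorem IsModularJ.exists_im_imp_smul (hj : IsModularJ j) :
    ∃ Y : ℝ, ∀ z w : ℍ, Y ≤ z.im → Y ≤ w.im → j z = j w → ∃ γ : SL(2, ℤ), γ • z = w := by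
  obtain ⟨h, K, t, ht, hK, hh⟩ := hj.exists_lipschitz_qExpansion
  have hq := (Function.Periodic.qParam_tendsto one_pos).mono_right nhdsWithin_le_nhds
  have h1 : Tendsto (fun z => K * ‖Function.Periodic.qParam 1 z‖) (comap Complex.im atTop)
      (𝓝 0) := by
    simpa using hq.norm.const_mul (K : ℝ)
  obtain ⟨Y, -, hY⟩ := (atTop_basis.comap Complex.im).eventually_iff.1
    ((hq.eventually_mem ht).and (h1.eventually_lt_const one_pos))
  refine ⟨Y, fun z w hz hw hzw => ?_⟩
  obtain ⟨hz1, hz2⟩ := hY hz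
  obtain ⟨hw1, -⟩ := hY hw
  have hqq : Function.Periodic.qParam 1 (w : ℂ) = Function.Periodic.qParam 1 z := by
    rw [hh, hh] at hzw
    have hqz := Function.Periodic.qParam_ne_zero (h := 1) (z : ℂ)
    have hqw := Function.Periodic.qParam_ne_zero (h := 1) (w : ℂ)
    have hw2 := Function.Periodic.norm_qParam_lt_one one_pos w.im_pos
    generalize Function.Periodic.qParam 1 (w : ℂ) = q at *
    generalize Function.Periodic.qParam 1 (z : ℂ) = p at *
    by_contra hne
    have h2 : q - p = (h q - h p) * p * q := by
      have : h q - h p = p⁻¹ - q⁻¹ := by linear_combination -hzw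
      rw [this]
      field_simp
    have h3 : ‖h q - h p‖ ≤ K * ‖q - p‖ := hK.norm_sub_le hw1 hz1
    have h4 : 0 < ‖q - p‖ := norm_pos_iff.2 (sub_ne_zero.2 hne)
    have h5 : ‖q - p‖ ≤ K * ‖q - p‖ * ‖p‖ * ‖q‖ := by
      conv_lhs => rw [h2, norm_mul, norm_mul]
      gcongr
    have h6 : K * ‖p‖ * ‖q‖ < 1 := by
      have := mul_le_of_le_one_right (by positivity : 0 ≤ K * ‖p‖) hw2.le
      linarith
    nlinarith
  simp only [Function.Periodic.qParam, Complex.exp_eq_exp_iff_exists_int] at hqq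
  obtain ⟨n, hn⟩ := hqq
  refine ⟨T ^ n, UpperHalfPlane.ext ?_⟩
  rw [coe_T_zpow_smul_eq]
  have := Complex.two_pi_I_ne_zero
  apply mul_left_cancel₀ this
  simp only [Complex.ofReal_one, div_one] at hn
  linear_combination -hn

theorem IsModularJ.continuous_comp_coe (hj : IsModularJ j) : Continuous fun τ : ℍ => j τ :=
  hj.holo.continuousOn.comp_continuous UpperHalfPlane.continuous_coe fun τ => τ.im_pos

theorem isOpen_HH : IsOpen HH := isOpen_lt continuous_const Complex.continuous_im

theorem isPreconnected_HH : IsPreconnected HH :=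
  ((convex_halfSpace_im_gt 0).isPreconnected)

theorem IsModularJ.analyticOnNhd (hj : IsModularJ j) : AnalyticOnNhd ℂ j HH :=
  hj.holo.analyticOnNhd isOpen_HH

theorem IsModularJ.not_const (hj : IsModularJ j) (c : ℂ) : ¬ ∀ z ∈ HH, j z = c := by
  intro h
  obtain ⟨Y, hY⟩ := hj.exists_norm_gt ‖c‖
  have hpos : 0 < max Y 1 := by positivity
  have := hY ⟨⟨0, max Y 1⟩, hpos⟩ (le_max_left _ _)
  rw [h _ (UpperHalfPlane.im_pos _)] at this
  exact lt_irrefl _ this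

theorem IsModularJ.nhds_le_map (hj : IsModularJ j) (τ : ℍ) :
    𝓝 (j τ) ≤ map (fun τ : ℍ => j τ) (𝓝 τ) := by
  rcases (hj.analyticOnNhd τ τ.im_pos).eventually_constant_or_nhds_le_map_nhds with h | h
  · refine absurd (fun z hz => ?_) (hj.not_const (j τ))
    exact hj.analyticOnNhd.eqOn_of_preconnected_of_eventuallyEq analyticOnNhd_const
      isPreconnected_HH τ.im_pos h hz
  · refine h.trans ?_
    rw [← (isOpenEmbedding_coe.map_nhds_eq τ), map_map]
    rfl

theorem countable_deriv_eq_zero (hj : IsModularJ j) : {z | z ∈ HH ∧ deriv j z = 0}.Countable := by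
  have hd : AnalyticOnNhd ℂ (deriv j) HH := hj.analyticOnNhd.deriv
  have : DiscreteTopology {z | z ∈ HH ∧ deriv j z = 0} := by
    rw [discreteTopology_subtype_iff]
    rintro x ⟨hx, -⟩
    by_contra hne
    have hfr : ∃ᶠ z in 𝓝[≠] x, deriv j z = 0 := by
      rw [← Ne.eq_def, ← neBot_iff, ← frequently_mem_iff_neBot] at hne
      exact hne.mono fun z hz => hz.2
    have h0 := hd.eqOn_zero_of_preconnected_of_frequently_eq_zero isPreconnected_HH hx hfr
    refine hj.not_const (j x) fun z hz => ?_
    exact isOpen_HH.is_const_of_deriv_eq_zero isPreconnected_HH hj.holo h0 hz hx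
  exact Set.countable_coe_iff.1 (countable_of_Lindelof_of_discrete)

theorem isClosed_orbitRel : IsClosed {p : ℍ × ℍ | ∃ γ : SL(2, ℤ), γ • p.1 = p.2} := by
  have : T2Space (Quotient (MulAction.orbitRel 𝒮ℒ ℍ)) :=
    t2Space_of_properlyDiscontinuousSMul_of_t2Space
  have h := isClosed_eq
    ((continuous_quotient_mk' (s := MulAction.orbitRel 𝒮ℒ ℍ)).comp continuous_snd)
    (continuous_quotient_mk'.comp continuous_fst)
  convert h using 1
  ext p
  simp only [Set.mem_ofPred_eq, Function.comp_apply]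
  rw [Quotient.eq', MulAction.orbitRel_apply]
  constructor
  · rintro ⟨γ, hγ⟩
    exact ⟨⟨_, γ, rfl⟩, hγ⟩
  · rintro ⟨⟨_, γ, rfl⟩, hγ⟩
    exact ⟨γ, hγ⟩

theorem exists_nhds_injOn {z : ℂ} (hj : IsModularJ j) (hz : z ∈ HH) (hd : deriv j z ≠ 0) :
    ∃ t ∈ 𝓝 z, Set.InjOn j t := by
  have hs := (hj.analyticOnNhd z hz).hasStrictDerivAt
  refine ⟨_, hs.eventually_left_inverse hd, fun x hx y hy hxy => ?_⟩
  rw [← Set.mem_ofPred_eq.mp hx, ← Set.mem_ofPred_eq.mp hy, hxy]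

/-- The points of the upper half-plane that share their `j`-value with a point of another
`SL₂(ℤ)`-orbit. -/
def nonSeparated (j : ℂ → ℂ) : Set ℍ :=
  {z | ∃ w : ℍ, j z = j w ∧ ¬ ∃ γ : SL(2, ℤ), γ • z = w}

theorem isOpen_nonSeparated (hj : IsModularJ j) : IsOpen (nonSeparated j) := by
  rw [isOpen_iff_mem_nhds]
  rintro z ⟨w, hzw, hγ⟩
  obtain ⟨A, hA, B, hB, hAB⟩ := mem_nhds_prod_iff.1
    (isClosed_orbitRel.isOpen_compl.mem_nhds (x := (z, w)) hγ)
  have h1 : (fun τ : ℍ => j τ) '' B ∈ 𝓝 (j z) := by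
    rw [hzw]
    exact hj.nhds_le_map w (image_mem_map hB)
  filter_upwards [hA, hj.continuous_comp_coe.continuousAt h1] with z' hz' hj'
  obtain ⟨w', hw', hjw⟩ := hj'
  exact ⟨w', hjw.symm, hAB (Set.mk_mem_prod hz' hw')⟩

theorem exists_mem_fd_of_mem_nonSeparated (hj : IsModularJ j) {z : ℍ}
    (hz : z ∈ nonSeparated j) :
    ∃ w ∈ 𝒟, j z = j w ∧ ¬ ∃ γ : SL(2, ℤ), γ • z = w := by
  obtain ⟨w, hzw, hγ⟩ := hz
  obtain ⟨δ, hδ⟩ := exists_smul_mem_fd w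
  refine ⟨δ • w, hδ, by rw [hj.apply_smul, hzw], fun ⟨γ, h⟩ => hγ ⟨δ⁻¹ * γ, ?_⟩⟩
  rw [mul_smul, h, inv_smul_smul]

theorem mem_nonSeparated_of_mem_closure (hj : IsModularJ j) {z : ℍ}
    (hz : z ∈ closure (nonSeparated j)) (hd : deriv j z ≠ 0) : z ∈ nonSeparated j := by
  obtain ⟨u, hu, hlim⟩ := mem_closure_iff_seq_limit.1 hz
  have hjlim : Tendsto (fun n => j (u n)) atTop (𝓝 (j z)) :=
    (hj.continuous_comp_coe.tendsto z).comp hlim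
  choose w hw hjw hγ using fun n => exists_mem_fd_of_mem_nonSeparated hj (hu n)
  obtain ⟨Y, hY⟩ := hj.exists_norm_gt (‖j z‖ + 1)
  have hev : ∀ᶠ n in atTop, w n ∈ truncatedFundamentalDomain Y := by
    filter_upwards [hjlim.norm.eventually_lt_const (lt_add_one _)] with n hn
    refine ⟨hw n, le_of_not_ge fun h => ?_⟩
    have := hY _ h
    rw [← hjw] at this
    exact lt_asymm hn this
  obtain ⟨w₀, -, φ, hφ, hwlim⟩ :=
    (isCompact_truncatedFundamentalDomain Y).tendsto_subseq' hev.frequently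
  have hlim' := hlim.comp hφ.tendsto_atTop
  have hjw₀ : j z = j w₀ := by
    refine tendsto_nhds_unique (hjlim.comp hφ.tendsto_atTop) ?_
    simpa only [Function.comp_def, hjw] using (hj.continuous_comp_coe.tendsto w₀).comp hwlim
  refine ⟨w₀, hjw₀, fun ⟨γ, h⟩ => ?_⟩
  obtain ⟨t, ht, hinj⟩ := exists_nhds_injOn hj z.im_pos hd
  have ht' : UpperHalfPlane.coe ⁻¹' t ∈ 𝓝 z := UpperHalfPlane.continuous_coe.continuousAt ht
  have hwz : Tendsto (fun n => γ⁻¹ • w (φ n)) atTop (𝓝 z) := by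
    have hc : Continuous fun τ : ℍ => γ⁻¹ • τ :=
      continuous_const_smul (Matrix.SpecialLinearGroup.toGL
        (Matrix.SpecialLinearGroup.map (Int.castRingHom ℝ) γ⁻¹))
    have := hc.tendsto w₀
    rw [← h, inv_smul_smul, h] at this
    exact this.comp hwlim
  obtain ⟨n, hn1, hn2⟩ := ((hlim'.eventually_mem ht').and (hwz.eventually_mem ht')).exists
  refine hγ (φ n) ⟨γ, ?_⟩
  rw [← eq_inv_smul_iff]
  refine UpperHalfPlane.ext (hinj hn1 hn2 ?_)
  rw [hj.apply_smul]
  exact hjw _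

/-- A homeomorphic parametrisation of the upper half-plane by the complex plane. -/
def expChart (w : ℂ) : ℍ := ⟨⟨w.re, Real.exp w.im⟩, Real.exp_pos _⟩

theorem continuous_expChart : Continuous expChart := by
  rw [isEmbedding_coe.continuous_iff]
  exact Complex.equivRealProdCLM.symm.continuous.comp
    (Complex.continuous_re.prodMk (Real.continuous_exp.comp Complex.continuous_im))

theorem expChart_injective : Function.Injective expChart := by
  intro z w h
  have hre := congrArg UpperHalfPlane.re h
  have him := congrArg UpperHalfPlane.im h
  exact Complex.ext hre (Real.exp_injective him)

theorem expChart_surjective : Function.Surjective expChart := fun τ =>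
  ⟨⟨τ.re, Real.log τ.im⟩, UpperHalfPlane.ext (Complex.ext rfl (Real.exp_log τ.im_pos))⟩

theorem IsModularJ.exists_smul_of_apply_eq (hj : IsModularJ j) (z w : ℍ) (h : j z = j w) :
    ∃ γ : SL(2, ℤ), γ • z = w := by
  by_contra hγ
  have hz : z ∈ nonSeparated j := ⟨w, h, hγ⟩
  obtain ⟨z₀, rfl⟩ := expChart_surjective z
  set F : Set ℂ := {w | deriv j (expChart w) = 0} with hF
  have hFc : F.Countable := by
    refine ((countable_deriv_eq_zero hj).preimage (f := fun w => (expChart w : ℂ))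
      fun x y hxy => expChart_injective (UpperHalfPlane.ext hxy)).mono fun w hw => ?_
    exact ⟨(expChart w).im_pos, hw⟩
  have hFd : Dense Fᶜ := hFc.dense_compl ℂ
  have hU : IsOpen (expChart ⁻¹' nonSeparated j) :=
    (isOpen_nonSeparated hj).preimage continuous_expChart
  have hsub : Fᶜ ⊆ expChart ⁻¹' nonSeparated j := by
    refine (hFc.isConnected_compl_of_one_lt_rank (by simp)).isPreconnected
      |>.subset_of_closure_inter_subset hU ?_ ?_
    · rw [Set.inter_comm]
      exact hFd.inter_open_nonempty _ hU ⟨z₀, hz⟩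
    · rintro x ⟨hx, hxF⟩
      exact mem_nonSeparated_of_mem_closure hj
        (continuous_expChart.closure_preimage_subset _ hx) hxF
  obtain ⟨Y, hY⟩ := hj.exists_im_imp_smul
  obtain ⟨M, hM⟩ := ((isCompact_truncatedFundamentalDomain Y).image
    hj.continuous_comp_coe).isBounded.exists_norm_le
  obtain ⟨Y', hY'⟩ := hj.exists_norm_gt M
  obtain ⟨x, hxY, hxF⟩ := hFd.inter_open_nonempty {x : ℂ | max Y Y' < (expChart x).im}
    (isOpen_lt continuous_const (UpperHalfPlane.continuous_im.comp continuous_expChart))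
    ((expChart_surjective ⟨⟨0, max (max Y Y') 0 + 1⟩, by positivity⟩).imp fun x hx => by
      rw [Set.mem_ofPred_eq, hx]
      exact (le_max_left _ _).trans_lt (lt_add_one _))
  obtain ⟨v, hv, hjv, hγv⟩ := exists_mem_fd_of_mem_nonSeparated hj (hsub hxF)
  have hxY' : Y < (expChart x).im ∧ Y' < (expChart x).im := max_lt_iff.1 hxY
  refine hγv (hY _ _ hxY'.1.le (le_of_not_ge fun hvY => ?_) hjv)
  have := hY' _ hxY'.2.le
  rw [hjv] at this
  exact this.not_ge (hM _ ⟨v, ⟨hv, hvY⟩, rfl⟩)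

end Injectivity

/-! ### Generic points of constructible families via an ultrapower of `ℂ` -/

section Ultrapower

open Filter Cardinal

theorem exists_ringHom_comp_eq {K L : Type} [Field K] [Field L] [Countable K]
    (hL : #L ≤ 𝔠) (f : K →+* L) (g : K →+* ℂ) : ∃ σ : L →+* ℂ, σ.comp f = g := by
  let := f.toAlgebra
  let := g.toAlgebra
  obtain ⟨s, hs⟩ := exists_isTranscendenceBasis K L
  obtain ⟨t, ht⟩ := exists_isTranscendenceBasis K ℂ
  have h1 : #ℂ = #t := IsAlgClosed.cardinal_eq_cardinal_transcendence_basis_of_aleph0_lt' _ ht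
    mk_le_aleph0 (by rw [mk_complex]; exact aleph0_lt_continuum)
  have h2 : #s ≤ #t := by
    rw [← h1, mk_complex]; exact (mk_set_le s).trans hL
  obtain ⟨e⟩ : Nonempty (s ↪ t) := h2
  let A := Algebra.adjoin K (Set.range ((↑) : s → L))
  let φ : A →ₐ[K] ℂ :=
    (MvPolynomial.aeval (fun i : s => (e i : ℂ))).comp hs.1.aevalEquiv.symm.toAlgHom
  have hφ : Function.Injective φ := by
    have h3 : AlgebraicIndependent K (fun i : s => (e i : ℂ)) := ht.1.comp e e.injective
    have h3' : Function.Injective (MvPolynomial.aeval (R := K) (fun i : s => (e i : ℂ))) := h3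
    exact h3'.comp hs.1.aevalEquiv.symm.injective
  let : Algebra A ℂ := φ.toRingHom.toAlgebra
  have : Module.IsTorsionFree A ℂ := Module.isTorsionFree_iff_algebraMap_injective.2 hφ
  have : Algebra.IsAlgebraic A L := hs.isAlgebraic
  let ψ : L →ₐ[A] ℂ := IsAlgClosed.lift
  refine ⟨ψ.toRingHom, ?_⟩
  ext x
  have h4 : f x = algebraMap A L (algebraMap K A x) := rfl
  have h5 : g x = algebraMap A ℂ (algebraMap K A x) := (φ.commutes x).symm
  simp only [RingHom.comp_apply, h4, h5]
  exact ψ.commutes _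

/-- The ultrapower of `ℂ` along a nonprincipal ultrafilter on `ℕ`. -/
abbrev Ultrapower : Type := Germ (hyperfilter ℕ : Filter ℕ) ℂ

/-- The diagonal embedding of `ℂ` in its ultrapower. -/
def diagHom : ℂ →+* Ultrapower :=
  (Germ.coeRingHom (hyperfilter ℕ : Filter ℕ)).comp (Pi.constRingHom ℕ ℂ)

theorem mk_ultrapower_le : #Ultrapower ≤ 𝔠 := by
  have h : #(ℕ → ℂ) = 𝔠 := by simp
  rw [← h]
  exact mk_le_of_surjective (f := fun x : ℕ → ℂ => (x : Ultrapower))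
    fun y => Germ.inductionOn y fun x => ⟨x, rfl⟩

theorem exists_ultrapower_hom (C : Set ℂ) (hC : C.Countable) :
    ∃ σ : Ultrapower →+* ℂ, ∀ c ∈ C, σ (diagHom c) = c := by
  let K := Subfield.closure C
  have : Countable K := by
    rw [← mk_le_aleph0_iff]
    exact (Subfield.cardinalMk_closure_le_max C).trans (max_le hC.le_aleph0 le_rfl)
  obtain ⟨σ, hσ⟩ := exists_ringHom_comp_eq mk_ultrapower_le (diagHom.comp K.subtype) K.subtype
  exact ⟨σ, fun c hc => DFunLike.congr_fun hσ (⟨c, Subfield.subset_closure hc⟩ : K)⟩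

/-- The image in `ℂ^ι` of the class of a sequence of points of `ℂ^ι`. -/
def specialize {ι : Type*} (σ : Ultrapower →+* ℂ) (x : ℕ → ι → ℂ) : ι → ℂ :=
  fun k => σ (fun i => x i k : ℕ → ℂ)

/-- Membership in `S` transfers along every ultrapower specialization that fixes `C`. -/
def TransfersOver {ι : Type*} (C : Set ℂ) (S : Set (ι → ℂ)) : Prop :=
  ∀ σ : Ultrapower →+* ℂ, (∀ c ∈ C, σ (diagHom c) = c) → ∀ x : ℕ → ι → ℂ,
    (∀ᶠ i in (hyperfilter ℕ : Filter ℕ), x i ∈ S) ↔ specialize σ x ∈ S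

theorem TransfersOver.mono {ι : Type*} {C D : Set ℂ} {S : Set (ι → ℂ)}
    (h : TransfersOver C S) (hCD : C ⊆ D) : TransfersOver D S :=
  fun σ hσ => h σ fun c hc => hσ c (hCD hc)

theorem specialize_eq_iff {ι : Type*} (σ : Ultrapower →+* ℂ) (x y : ℕ → ι → ℂ) (k : ι) :
    specialize σ x k = specialize σ y k ↔
      ∀ᶠ i in (hyperfilter ℕ : Filter ℕ), x i k = y i k :=
  σ.injective.eq_iff.trans Germ.coe_eq

theorem transfersOver_zeros {ι : Type*} [Fintype ι] (p : MvPolynomial ι ℂ) :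
    TransfersOver (p.coeff '' p.support) {x | MvPolynomial.eval x p = 0} := by
  intro σ hσ x
  have h1 : ((fun i => MvPolynomial.eval (x i) p : ℕ → ℂ) : Ultrapower) =
      MvPolynomial.eval₂ diagHom (fun k => ((fun i => x i k : ℕ → ℂ) : Ultrapower)) p := by
    have h2 : (fun i => MvPolynomial.eval (x i) p : ℕ → ℂ) =
        MvPolynomial.eval₂ (Pi.constRingHom ℕ ℂ) (fun k i => x i k) p := by
      funext i
      simp [MvPolynomial.eval₂_eq', MvPolynomial.eval_eq']
    rw [h2]
    let φ : (ℕ → ℂ) →+* Ultrapower := Germ.coeRingHom (hyperfilter ℕ : Filter ℕ)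
    exact MvPolynomial.eval₂_comp_left φ _ _ p
  have h3 : σ ((fun i => MvPolynomial.eval (x i) p : ℕ → ℂ) : Ultrapower) =
      MvPolynomial.eval (specialize σ x) p := by
    rw [h1, MvPolynomial.eval₂_eq', map_sum, MvPolynomial.eval_eq']
    refine Finset.sum_congr rfl fun d hd => ?_
    rw [map_mul, hσ _ ⟨d, hd, rfl⟩, map_prod]
    simp [specialize]
  rw [Set.mem_ofPred_eq, ← h3, map_eq_zero_iff σ σ.injective]
  exact (Germ.coe_eq (g := fun _ => (0 : ℂ))).symm

theorem IsAlgSet.exists_finset {ι : Type*} [Finite ι] {V : Set (ι → ℂ)} (hV : IsAlgSet V) :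
    ∃ P : Finset (MvPolynomial ι ℂ), V = {x | ∀ p ∈ P, MvPolynomial.eval x p = 0} := by
  obtain ⟨P, rfl⟩ := hV
  obtain ⟨s, hs⟩ := (isNoetherianRing_iff_ideal_fg _).1 inferInstance (Ideal.span P)
  refine ⟨s, ?_⟩
  ext x
  have key : ∀ P : Set (MvPolynomial ι ℂ), (∀ p ∈ P, MvPolynomial.eval x p = 0) ↔
      Ideal.span P ≤ RingHom.ker (MvPolynomial.eval x) := fun P => by
    rw [Ideal.span_le]; rfl
  exact (key P).trans (hs ▸ (key s).symm)

theorem IsAlgSet.exists_transfersOver {ι : Type*} [Fintype ι] {V : Set (ι → ℂ)}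
    (hV : IsAlgSet V) : ∃ C : Set ℂ, C.Countable ∧ TransfersOver C V := by
  obtain ⟨P, rfl⟩ := hV.exists_finset
  refine ⟨⋃ p ∈ P, p.coeff '' p.support, ?_, fun σ hσ x => ?_⟩
  · exact P.countable_toSet.biUnion fun p _ => (p.support.countable_toSet.image _)
  · simp only [Set.mem_ofPred_eq]
    rw [eventually_all_finset]
    refine forall₂_congr fun p hp => ?_
    exact (transfersOver_zeros p).mono (Set.subset_biUnion_of_mem (u := fun p =>
      p.coeff '' p.support) hp) σ hσ x

theorem IsConstr.exists_transfersOver {ι : Type*} [Fintype ι] {S : Set (ι → ℂ)}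
    (hS : IsConstr S) : ∃ C : Set ℂ, C.Countable ∧ TransfersOver C S := by
  obtain ⟨k, A, B, hAB, rfl⟩ := hS
  choose C hC hCA using fun i => (hAB i).1.exists_transfersOver
  choose D hD hDB using fun i => (hAB i).2.exists_transfersOver
  refine ⟨⋃ i, C i ∪ D i, Set.countable_iUnion fun i => (hC i).union (hD i), fun σ hσ x => ?_⟩
  simp only [Set.mem_iUnion, Set.mem_sdiff, Ultrafilter.eventually_exists_iff, eventually_and,
    Ultrafilter.eventually_not]
  refine exists_congr fun i => and_congr ?_ (not_congr ?_)
  · exact (hCA i).mono (Set.subset_union_left.trans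
      (Set.subset_iUnion (fun i => C i ∪ D i) i)) σ hσ x
  · exact (hDB i).mono (Set.subset_union_right.trans
      (Set.subset_iUnion (fun i => C i ∪ D i) i)) σ hσ x

theorem finite_noConstCoord_fibers {ι κ : Type*} [Fintype ι] [Fintype κ] {Q : Set (κ → ℂ)}
    (hQ : IsConstr Q) {F : Set (ι ⊕ κ → ℂ)} (hF : IsConstr F) {𝒯 : Set (Set (ι → ℂ))}
    (h𝒯 : 𝒯.Countable) (halg : ∀ T ∈ 𝒯, IsAlgSet T)
    (hmem : ∀ q ∈ Q, NoConstCoord (fib F q) → fib F q ∈ 𝒯) :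
    {T | (∃ q ∈ Q, fib F q = T) ∧ NoConstCoord T}.Finite := by
  by_contra hinf
  rw [← Set.Infinite] at hinf
  let f := hinf.natEmbedding
  choose q hqQ hq using fun i => (f i).2.1
  have hnc : ∀ i, NoConstCoord (fib F (q i)) := fun i => (hq i).symm ▸ (f i).2.2
  obtain ⟨CQ, hCQ, hTQ⟩ := hQ.exists_transfersOver
  obtain ⟨CF, hCF, hTF⟩ := hF.exists_transfersOver
  choose! CT hCT hTT using fun T hT => (halg T hT).exists_transfersOver
  obtain ⟨σ, hσ⟩ := exists_ultrapower_hom (CQ ∪ CF ∪ ⋃ T ∈ 𝒯, CT T)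
    ((hCQ.union hCF).union (h𝒯.biUnion hCT))
  have hσQ := hTQ σ fun c hc => hσ c (Or.inl (Or.inl hc))
  have hσF := hTF σ fun c hc => hσ c (Or.inl (Or.inr hc))
  have hσT : ∀ T ∈ 𝒯, _ := fun T hT =>
    hTT T hT σ fun c hc => hσ c (Or.inr (Set.mem_biUnion hT hc))
  have hfib : ∀ x : ℕ → ι → ℂ, (∀ᶠ i in (hyperfilter ℕ : Filter ℕ), x i ∈ fib F (q i)) ↔
      specialize σ x ∈ fib F (specialize σ q) := fun x => by
    have h1 : specialize σ (fun i => Sum.elim (x i) (q i)) =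
        Sum.elim (specialize σ x) (specialize σ q) := by
      funext k
      cases k <;> rfl
    have h2 := hσF fun i => Sum.elim (x i) (q i)
    rwa [h1] at h2
  have hT : fib F (specialize σ q) ∈ 𝒯 := by
    refine hmem _ ((hσQ q).1 (Eventually.of_forall hqQ)) fun k c => ?_
    choose v hv _ using fun i => hnc i k 0
    choose w hw hvw using fun i => hnc i k (v i k)
    have h1 := (hfib v).1 (Eventually.of_forall hv)
    have h2 := (hfib w).1 (Eventually.of_forall hw)
    have h3 : specialize σ w k ≠ specialize σ v k := by
      rw [Ne, specialize_eq_iff, ← Ultrafilter.eventually_not]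
      exact Eventually.of_forall hvw
    by_cases h4 : specialize σ v k = c
    · exact ⟨_, h2, h4 ▸ h3⟩
    · exact ⟨_, h1, h4⟩
  have hx : ∀ i, ∃ x : ι → ℂ, fib F (q i) ≠ fib F (specialize σ q) →
      ¬ (x ∈ fib F (q i) ↔ x ∈ fib F (specialize σ q)) := fun i => by
    by_contra! h
    exact (h 0).1 (Set.ext fun x => (h x).2)
  choose x hx using hx
  have hne : ∀ᶠ i in (hyperfilter ℕ : Filter ℕ), fib F (q i) ≠ fib F (specialize σ q) := by
    have : {i | ¬ fib F (q i) ≠ fib F (specialize σ q)}.Finite := by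
      refine Set.Subsingleton.finite fun i hi i' hi' => f.injective (Subtype.ext ?_)
      simp only [ne_eq, not_not, Set.mem_ofPred_eq] at hi hi'
      rw [← hq i, ← hq i', hi, hi']
    filter_upwards [hyperfilter_le_cofinite this.compl_mem_cofinite] with i hi
    simpa using hi
  have h1 : ∀ᶠ i in (hyperfilter ℕ : Filter ℕ),
      ¬ (x i ∈ fib F (q i) ↔ x i ∈ fib F (specialize σ q)) := hne.mono hx
  have h2 := (hfib x).trans (hσT _ hT x).symm
  rw [Ultrafilter.eventually_not] at h1
  refine h1 ?_
  by_cases h3 : ∀ᶠ i in (hyperfilter ℕ : Filter ℕ), x i ∈ fib F (q i)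
  · filter_upwards [h3, h2.1 h3] with i h4 h5 using ⟨fun _ => h5, fun _ => h4⟩
  · have h4 := mt h2.2 h3
    rw [← Ultrafilter.eventually_not] at h3 h4
    filter_upwards [h3, h4] with i h5 h6 using ⟨fun h => absurd h h5, fun h => absurd h h6⟩

end Ultrapower

/-! ### Countability of the basic special subvarieties -/

theorem countable_isWSpecial_noConstCoord {ι : Type*} [Finite ι] {j : ℂ → ℂ}
    (hj : IsModularJ j) : {T : Set (ι → ℂ) | IsWSpecial j T ∧ NoConstCoord T}.Countable := by
  let base : Set (ι × ι × ℕ) → Set (ι → ℂ) :=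
    fun R => {y | ∀ r ∈ R, PhiRel j r.2.2 (y r.1) (y r.2.1)}
  have hc : (⋃ R ∈ {R : Set (ι × ι × ℕ) | R.Finite}, {T | IsIrrCompOf T (base R)}).Countable :=
    Set.Countable.biUnion (Set.Countable.ofPred_finite)
      fun R _ => (finite_irrCompOf _).countable
  refine hc.mono ?_
  rintro T ⟨⟨R, E, hR, hT⟩, hnc⟩
  have hE : E = ∅ := Set.eq_empty_of_forall_notMem fun e he =>
    hT.not_noConstCoord e.1 (Set.finite_singleton e.2) (fun y hy => hy.2 e he) hnc
  have hinj : Set.InjOn (fun r : ι × ι × ℕ => (r.1, r.2.1)) R := by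
    rintro ⟨i, k, M⟩ hM ⟨i', k', N⟩ hN h
    obtain ⟨rfl, rfl⟩ := Prod.mk.inj h
    by_contra hne
    have hMN : M ≠ N := fun h => hne (by rw [h])
    exact hT.not_noConstCoord i
      (finite_inter_phiRel hj hj.exists_smul_of_apply_eq (hR _ hM) (hR _ hN) hMN)
      (fun y hy => ⟨y k, hy.1 _ hM, hy.1 _ hN⟩) hnc
  have hfin : R.Finite := Set.Finite.of_finite_image (Set.toFinite _) hinj
  refine Set.mem_biUnion hfin ?_
  simpa [base, hE] using hT

/-- In a parametric family `(S_q)_{q ∈ Q}` of proper weakly special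
subvarieties of a special subvariety `S ⊆ Y(1)ⁿ`, only finitely many members are basic
special subvarieties. -/
theorem finitely_many_basic_specials_in_family
    (j : ℂ → ℂ) (hj : IsModularJ j)
    (n m : ℕ) (S : Set (Fin n → ℂ)) (hS : IsSpecial j S)
    (Q : Set (Fin m → ℂ)) (hQ : IsConstr Q)
    (F : Set ((Fin n ⊕ Fin m) → ℂ)) (hF : IsConstr F)
    (hfam : ∀ v ∈ F, (fun k => v (Sum.inr k)) ∈ Q)
    (hwsp : ∀ q ∈ Q, IsWSpecial j (fib F q) ∧ fib F q ⊆ S ∧ fib F q ≠ S) :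
    {T : Set (Fin n → ℂ) | (∃ q ∈ Q, fib F q = T) ∧ IsBasicSpecial j T}.Finite := by
  refine (finite_noConstCoord_fibers hQ hF (countable_isWSpecial_noConstCoord hj)
    (fun T hT => ?_) fun q hq hnc => ⟨(hwsp q hq).1, hnc⟩).subset fun T hT => ⟨hT.1, hT.2.2⟩
  obtain ⟨⟨_, _, _, h⟩, _⟩ := hT
  exact h.1

end ModularJPaper
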